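/- arXiv:math/0509269 — 5 statements merged into one kernel-verified Lean document; each statement's English description precedes it below -/
import Mathlib

section
/- Let X be a compact Hausdorff space and n ≥ 1. Identify C(X, ℂ)ⁿ with C(X, ℂⁿ) via (f₁,…,fₙ) ↦ (x ↦ (f₁(x),…,fₙ(x))). Let N := {f ∈ C(X, ℂⁿ) : f(x) ≠ 0 for all x ∈ X}, with the compact-open topology, and let eₙ also denote the constant map with value (0,…,0,1). Then for a tuple (f₁,…,fₙ) corresponding to f ∈ N, the following are equivalent: (a) f lies in the path component of the constant map eₙ in N; (b) there exists u ∈ GLₙ(C(X, ℂ)) lying in the path component of the identity in GLₙ(C(X, ℂ)) such that u·eₙ = (f₁,…,fₙ). Equivalently, under the identification, the path component of eₙ in N equals the path component of eₙ in Lcₙ(C(X, ℂ)). -/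
open Matrix in
theorem aux_unit {X : Type*} [TopologicalSpace X] [CompactSpace X] {m : ℕ}
    (a b w : Fin m → C(X, ℂ)) (hw : ∀ x, (∑ i, w i x * a i x) = 1)
    (hp : ∀ x, 0 < (∑ i, w i x * b i x).re) (t : ℝ) (h0 : 0 ≤ t) (h1 : t ≤ 1) :
    IsUnit (1 + vecMulVec ((t : ℂ) • (b - a)) w) := by
  rw [Matrix.isUnit_iff_isUnit_det, vecMulVec_eq Unit, Matrix.det_one_add_replicateCol_mul_replicateRow,
    ContinuousMap.isUnit_iff_forall_ne_zero]
  intro x hx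
  have e : (1 + w ⬝ᵥ ((t : ℂ) • (b - a))) x
      = 1 + (t : ℂ) * ((∑ i, w i x * b i x) - 1) := by
    rw [← hw x, ← Finset.sum_sub_distrib, Finset.mul_sum, hw x]
    simp only [dotProduct, ContinuousMap.add_apply, ContinuousMap.one_apply,
      ContinuousMap.sum_apply, ContinuousMap.mul_apply, Pi.smul_apply, Pi.sub_apply,
      ContinuousMap.smul_apply, ContinuousMap.sub_apply, smul_eq_mul]
    congr 1
    exact Finset.sum_congr rfl fun i _ => by ring
  rw [e] at hx
  have := congrArg Complex.re hx
  simp only [Complex.add_re, Complex.one_re, Complex.re_ofReal_mul, Complex.sub_re,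
    Complex.zero_re] at this
  have hpx := hp x
  rcases h0.eq_or_lt with h | h
  · subst h; simp at this
  · nlinarith [mul_pos h hpx]

open Matrix in
theorem aux_step {X : Type*} [TopologicalSpace X] [CompactSpace X] {m : ℕ}
    (a b : Fin m → C(X, ℂ)) (ha : ∀ x, ∃ i, a i x ≠ 0)
    (hp : ∀ x, 0 < (∑ i, star (a i x) * b i x).re) :
    ∃ u : Matrix (Fin m) (Fin m) C(X, ℂ),
      JoinedIn {v : Matrix (Fin m) (Fin m) C(X, ℂ) | IsUnit v} 1 u ∧ u.mulVec a = b := by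
  have hs : ∀ x, 0 < ∑ i, ‖a i x‖ ^ 2 := by
    intro x
    obtain ⟨i, hi⟩ := ha x
    exact Finset.sum_pos' (fun _ _ => by positivity) ⟨i, Finset.mem_univ _, by positivity⟩
  let r : C(X, ℂ) := ⟨fun x => (((∑ i, ‖a i x‖ ^ 2)⁻¹ : ℝ) : ℂ), by
    refine Complex.continuous_ofReal.comp (Continuous.inv₀ (by fun_prop) fun x => (hs x).ne')⟩
  let w : Fin m → C(X, ℂ) := fun i => r * star (a i)
  have hwx : ∀ i x, w i x = (((∑ i, ‖a i x‖ ^ 2)⁻¹ : ℝ) : ℂ) * star (a i x) := fun i x => rfl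
  have hw : ∀ x, (∑ i, w i x * a i x) = 1 := by
    intro x
    simp only [hwx, mul_assoc, ← Finset.mul_sum]
    have : ∑ i, star (a i x) * a i x = ((∑ i, ‖a i x‖ ^ 2 : ℝ) : ℂ) := by
      push_cast
      exact Finset.sum_congr rfl fun i _ => Complex.conj_mul' _
    rw [this, ← Complex.ofReal_mul, inv_mul_cancel₀ (hs x).ne', Complex.ofReal_one]
  have hwp : ∀ x, 0 < (∑ i, w i x * b i x).re := by
    intro x
    simp only [hwx, mul_assoc, ← Finset.mul_sum]
    rw [Complex.re_ofReal_mul]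
    exact mul_pos (inv_pos.2 (hs x)) (hp x)
  refine ⟨1 + vecMulVec (b - a) w, ?_, ?_⟩
  · refine JoinedIn.ofLine (f := fun t : ℝ => 1 + vecMulVec ((t : ℂ) • (b - a)) w) ?_ ?_ ?_ ?_
    · refine Continuous.continuousOn ?_
      refine continuous_const.add (continuous_matrix fun i j => ?_)
      simp only [vecMulVec_apply, Pi.smul_apply]
      have : Continuous fun t : ℝ => (t : ℂ) • (b - a) i :=
        Complex.continuous_ofReal.smul continuous_const
      exact this.mul continuous_const
    · have h : ((0 : ℝ) : ℂ) • (b - a) = 0 := by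
        rw [Complex.ofReal_zero]; exact zero_smul ℂ _
      simp only [h, zero_vecMulVec, add_zero]
    · have h : ((1 : ℝ) : ℂ) • (b - a) = b - a := by
        rw [Complex.ofReal_one]; exact one_smul ℂ _
      simp only [h]
    · rintro _ ⟨t, ht, rfl⟩
      exact aux_unit a b w hw hwp t ht.1 ht.2
  · have : w ⬝ᵥ a = 1 := by
      ext x
      simpa [dotProduct, ContinuousMap.sum_apply] using hw x
    rw [add_mulVec, one_mulVec, vecMulVec_mulVec, this]
    simp

theorem aux_mul {X : Type*} [TopologicalSpace X] [CompactSpace X] {m : ℕ}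
    {u v : Matrix (Fin m) (Fin m) C(X, ℂ)}
    (hu : JoinedIn {v : Matrix (Fin m) (Fin m) C(X, ℂ) | IsUnit v} 1 u)
    (hv : JoinedIn {v : Matrix (Fin m) (Fin m) C(X, ℂ) | IsUnit v} 1 v) :
    JoinedIn {v : Matrix (Fin m) (Fin m) C(X, ℂ) | IsUnit v} 1 (u * v) := by
  obtain ⟨p, hp⟩ := hu
  obtain ⟨q, hq⟩ := hv
  refine ⟨⟨⟨fun t => p t * q t, ?_⟩, by simp, by simp⟩, fun t => (hp t).mul (hq t)⟩
  exact p.continuous.matrix_mul q.continuous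


/-- Let `X` be a compact Hausdorff space and `n ≥ 1` (size `n + 1 ≥ 1`).
Identify `C(X, ℂ)ⁿ` with `C(X, ℂⁿ)`.  Let `N` be the space of continuous maps `X → ℂⁿ ∖ {0}`
(compact-open topology), based at the constant map `eₙ = (0, …, 0, 1)`.  For `f ∈ N`, with
corresponding tuple `(f₁, …, fₙ)`, the following are equivalent: (a) `f` lies in the path
component of `eₙ` in `N`; (b) there is `u ∈ GLₙ(C(X, ℂ))` in the path component of the
identity with `u·eₙ = (f₁, …, fₙ)`. -/
theorem stmt_12
    (X : Type*) [TopologicalSpace X] [CompactSpace X] [T2Space X] (n : ℕ) :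
    -- `N = {f : C(X, ℂⁿ) : f(x) ≠ 0 for all x}`
    let N : Set C(X, Fin (n + 1) → ℂ) := {g | ∀ x : X, g x ≠ 0}
    -- the constant map with value `eₙ = (0, …, 0, 1)`
    let eN : C(X, Fin (n + 1) → ℂ) :=
      ContinuousMap.const X (Pi.single (Fin.last n) (1 : ℂ))
    -- the last standard basis vector of `C(X, ℂ)ⁿ`
    let ePi : Fin (n + 1) → C(X, ℂ) := Pi.single (Fin.last n) 1
    ∀ f : C(X, Fin (n + 1) → ℂ), f ∈ N →
      -- the tuple `(f₁, …, fₙ)` corresponding to `f`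
      ∀ F : Fin (n + 1) → C(X, ℂ),
        (F = fun i => (ContinuousMap.mk (fun v : Fin (n + 1) → ℂ => v i)
          (continuous_apply i)).comp f) →
        (JoinedIn N eN f ↔
          ∃ u : Matrix (Fin (n + 1)) (Fin (n + 1)) C(X, ℂ), IsUnit u ∧
            JoinedIn {v : Matrix (Fin (n + 1)) (Fin (n + 1)) C(X, ℂ) | IsUnit v} 1 u ∧
            u.mulVec ePi = F) := by
  intro N eN ePi f hf F hF
  let T : C(X, Fin (n + 1) → ℂ) → Fin (n + 1) → C(X, ℂ) := fun g i =>
    (ContinuousMap.mk (fun v : Fin (n + 1) → ℂ => v i) (continuous_apply i)).comp g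
  have hT : ∀ g i x, T g i x = g x i := fun _ _ _ => rfl
  have hTe : T eN = ePi := by
    funext i
    ext x
    by_cases h : i = Fin.last n
    · subst h; simp [hT, eN, ePi]
    · simp [hT, eN, ePi, h]
  have hF' : F = T f := hF
  rw [hF']
  constructor
  · rintro ⟨γ, hγ⟩
    have key : ∀ s t : unitInterval, ∃ u : Matrix (Fin (n + 1)) (Fin (n + 1)) C(X, ℂ),
        JoinedIn {v : Matrix (Fin (n + 1)) (Fin (n + 1)) C(X, ℂ) | IsUnit v} 1 u ∧
          u.mulVec (T (γ s)) = T (γ t) := by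
      have hne : ∀ s x, ∃ i, T (γ s) i x ≠ 0 := fun s x => Function.ne_iff.1 (hγ s x)
      have hc : Continuous fun p : unitInterval × X => γ p.1 p.2 := by fun_prop
      intro s t
      refine PreconnectedSpace.induction₂' (fun s t : unitInterval =>
        ∃ u : Matrix (Fin (n + 1)) (Fin (n + 1)) C(X, ℂ),
        JoinedIn {v : Matrix (Fin (n + 1)) (Fin (n + 1)) C(X, ℂ) | IsUnit v} 1 u ∧
          u.mulVec (T (γ s)) = T (γ t)) ?_ ?_ s t
      · intro s
        have hev : ∀ᶠ t in nhds s, ∀ x ∈ (Set.univ : Set X),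
            0 < (∑ i, star (γ s x i) * γ t x i).re := by
          refine isCompact_univ.eventually_forall_of_forall_eventually fun x _ => ?_
          have hcont : Continuous fun p : unitInterval × X =>
              (∑ i, star (γ s p.2 i) * γ p.1 p.2 i).re := by
            refine Complex.continuous_re.comp (continuous_finsetSum _ fun i _ => ?_)
            exact (((continuous_apply i).comp ((γ s).continuous.comp continuous_snd)).star).mul
              ((continuous_apply i).comp hc)
          refine hcont.continuousAt.eventually (lt_mem_nhds ?_)
          obtain ⟨i, hi⟩ := hne s x
          rw [hT] at hi
          simp only [Complex.re_sum]
          have : ∀ j, (star (γ s x j) * γ s x j).re = ‖γ s x j‖ ^ 2 := by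
            intro j
            have := Complex.conj_mul' (γ s x j)
            rw [Complex.star_def, this]
            norm_cast
          simp only [this]
          exact Finset.sum_pos' (fun _ _ => by positivity) ⟨i, Finset.mem_univ _, by positivity⟩
        filter_upwards [hev] with t ht
        refine ⟨aux_step _ _ (hne s) fun x => ht x trivial, aux_step _ _ (hne t) fun x => ?_⟩
        have := ht x trivial
        simp only [hT]
        rw [← Complex.conj_re] at this
        convert this using 2
        simp [map_sum, mul_comm]
      · refine ⟨?_⟩
        rintro a b c ⟨u, hu, hu'⟩ ⟨v, hv, hv'⟩
        exact ⟨v * u, aux_mul hv hu, by rw [← Matrix.mulVec_mulVec, hu', hv']⟩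
    obtain ⟨u, hu, hu'⟩ := key 0 1
    rw [γ.source, γ.target, hTe] at hu'
    exact ⟨u, hu.target_mem, hu, hu'⟩
  · rintro ⟨u, -, ⟨p, hp⟩, hu⟩
    let Φ : Matrix (Fin (n + 1)) (Fin (n + 1)) C(X, ℂ) → C(X, Fin (n + 1) → ℂ) :=
      fun v => ContinuousMap.pi (v.mulVec ePi)
    have hinj : ∀ v g, v.mulVec ePi = T g → Φ v = g := by
      intro v g h
      ext x i
      exact congrArg (fun k : Fin (n + 1) → C(X, ℂ) => k i x) h
    have hΦ : Continuous fun t => Φ (p t) := by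
      refine ContinuousMap.continuous_of_continuous_uncurry _ ?_
      refine continuous_pi fun i => ?_
      have h1 : Continuous fun t => (p t).mulVec ePi i :=
        (continuous_apply i).comp (p.continuous.matrix_mulVec continuous_const)
      change Continuous fun q : unitInterval × X => ((p q.1).mulVec ePi i) q.2
      fun_prop
    refine ⟨⟨⟨fun t => Φ (p t), hΦ⟩, ?_, ?_⟩, ?_⟩
    · simp only [p.source]
      exact hinj _ _ (by rw [Matrix.one_mulVec, hTe])
    · simp only [p.target]
      exact hinj _ _ hu
    · intro t x hx
      obtain ⟨w, hw⟩ := (hp t).exists_left_inv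
      have h0 : ∀ i, ((p t).mulVec ePi i) x = 0 := fun i => congrFun hx i
      have h2 : w.mulVec ((p t).mulVec ePi) = ePi := by
        rw [Matrix.mulVec_mulVec, hw, Matrix.one_mulVec]
      have h3 := congrArg (fun k : Fin (n + 1) → C(X, ℂ) => k (Fin.last n) x) h2
      simp only [Matrix.mulVec, dotProduct, ContinuousMap.sum_apply, ContinuousMap.mul_apply] at h3 h0
      simp [h0, ePi] at h3
end

section
/- Assume the direct-limit setting for C*-algebras described in the context, with every A_λ and A unital and all the homomorphisms φ_{λ,μ}, φ_{λ,∞} unital. If λ ∈ Λ, b ∈ A_λ, and φ_{λ,∞}(b) is invertible in A, then there exists μ ≥ λ such that φ_{λ,μ}(b) is invertible in A_μ. -/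
theorem aux_sa {A B : Type*} [CStarAlgebra A] [CStarAlgebra B] (ψ : A →⋆ₐ[ℂ] B)
    (h : A) (hh : IsSelfAdjoint h) (hu : IsUnit (ψ h)) :
    ∃ k : A, Commute h k ∧ ψ (h * k - 1) = 0 := by
  have h0 : (0 : ℝ) ∉ spectrum ℝ (ψ h) := spectrum.zero_notMem ℝ hu
  have hcl : IsOpen (spectrum ℝ (ψ h))ᶜ := (spectrum.isClosed (𝕜 := ℝ) (ψ h)).isOpen_compl
  obtain ⟨δ, hδ, hb⟩ := Metric.isOpen_iff.1 hcl 0 h0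
  have hpos : ∀ t : ℝ, 0 < max (t ^ 2) (δ ^ 2) := fun t => lt_max_of_lt_right (by positivity)
  have hcont : Continuous (fun t : ℝ => t / max (t ^ 2) (δ ^ 2)) :=
    continuous_id.div (by fun_prop) (fun t => (hpos t).ne')
  have hψ : IsSelfAdjoint (ψ h) := hh.map ψ
  have hψc : Continuous ψ := AddMonoidHomClass.continuous_of_bound ψ 1
    (fun x => by simpa using NonUnitalStarAlgHom.norm_apply_le ψ x)
  refine ⟨cfc (fun t : ℝ => t / max (t ^ 2) (δ ^ 2)) h, ?_, ?_⟩
  · have := cfc_commute_cfc (R := ℝ) id (fun t : ℝ => t / max (t ^ 2) (δ ^ 2)) h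
    rwa [cfc_id ℝ h] at this
  · have e1 : ψ (cfc (fun t : ℝ => t / max (t ^ 2) (δ ^ 2)) h)
        = cfc (fun t : ℝ => t / max (t ^ 2) (δ ^ 2)) (ψ h) :=
      StarAlgHomClass.map_cfc (S := ℂ) ψ _ h hcont.continuousOn hψc hh hψ
    have e2 : ψ h * cfc (fun t : ℝ => t / max (t ^ 2) (δ ^ 2)) (ψ h) = 1 := by
      conv_lhs => enter [1]; rw [← cfc_id ℝ (ψ h)]
      rw [← cfc_mul id _ (ψ h) continuous_id.continuousOn hcont.continuousOn,
        ← cfc_one ℝ (ψ h)]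
      apply cfc_congr
      intro t ht
      have h1 : δ ≤ |t| := by
        by_contra hlt
        exact hb (by simpa using hlt) ht
      have h2 : δ ^ 2 ≤ t ^ 2 := by
        rw [← sq_abs t]; gcongr
      have h3 : t ≠ 0 := by
        rintro rfl
        simp at h1; linarith
      simp only [id, max_eq_left h2, Pi.one_apply]
      field_simp
    rw [map_sub, map_mul, e1, e2, map_one, sub_self]

theorem aux_unit_s16 {A : Type*} [CStarAlgebra A] (x y : A) (hc : Commute x y)
    (hn : ‖x * y - 1‖ < 1) : IsUnit x := by
  have : IsUnit (x * y) := by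
    have := isUnit_one_sub_of_norm_lt_one (x := 1 - x * y) (by rwa [norm_sub_rev])
    simpa using this
  exact (hc.isUnit_mul_iff.1 this).1

/-- In the direct-limit setting for unital C*-algebras (directed set `Λ`,
unital *-homomorphisms `φ_{λμ} : A_λ → A_μ` and `ψ_λ = φ_{λ∞} : A_λ → B` satisfying
compatibility, the norm condition, and density of `⋃_λ ψ_λ(A_λ)` in `B`):
if `b ∈ A_λ` and `ψ_λ(b)` is invertible in `B`, then there is `μ ≥ λ` such that
`φ_{λμ}(b)` is invertible in `A_μ`. -/
theorem stmt_16
    {Λ : Type*} [Nonempty Λ] [Preorder Λ] [IsDirected Λ (· ≤ ·)]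
    (A : Λ → Type*) [∀ l, CStarAlgebra (A l)]
    (B : Type*) [CStarAlgebra B]
    (φ : ∀ ⦃l m : Λ⦄, l ≤ m → (A l →⋆ₐ[ℂ] A m))
    (ψ : ∀ l : Λ, A l →⋆ₐ[ℂ] B)
    (hφrefl : ∀ (l : Λ) (a : A l), φ (le_refl l) a = a)
    (hφtrans : ∀ (l m p : Λ) (h1 : l ≤ m) (h2 : m ≤ p) (a : A l),
      φ h2 (φ h1 a) = φ (h1.trans h2) a)
    (hcomp : ∀ (l m : Λ) (h : l ≤ m) (a : A l), ψ m (φ h a) = ψ l a)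
    (hnorm : ∀ (l : Λ) (a : A l), ψ l a = 0 → ∀ ε > 0,
      ∃ (m : Λ) (hm : l ≤ m), ∀ (p : Λ) (hp : m ≤ p), ‖φ (hm.trans hp) a‖ < ε)
    (hdense : Dense (⋃ l : Λ, Set.range (ψ l))) :
    ∀ (l : Λ) (b : A l), IsUnit (ψ l b) →
      ∃ (m : Λ) (h : l ≤ m), IsUnit (φ h b) := by
  intro l b hb
  obtain ⟨k₁, hc₁, hk₁⟩ := aux_sa (ψ l) (star b * b) (IsSelfAdjoint.star_mul_self b)
    (by rw [map_mul, map_star]; exact hb.star.mul hb)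
  obtain ⟨k₂, hc₂, hk₂⟩ := aux_sa (ψ l) (b * star b) (IsSelfAdjoint.mul_star_self b)
    (by rw [map_mul, map_star]; exact hb.mul hb.star)
  obtain ⟨m₁, hm₁, H₁⟩ := hnorm l _ hk₁ 1 one_pos
  obtain ⟨m₂, hm₂, H₂⟩ := hnorm l _ hk₂ 1 one_pos
  obtain ⟨p, hp₁, hp₂⟩ := exists_ge_ge m₁ m₂
  refine ⟨p, hm₁.trans hp₁, ?_⟩
  have n₁ := H₁ p hp₁
  have n₂ := H₂ p hp₂
  rw [map_sub, map_mul, map_one] at n₁ n₂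
  have u₁ := aux_unit_s16 _ _ (hc₁.map (φ (hm₁.trans hp₁))) n₁
  have u₂ := aux_unit_s16 _ _ (hc₂.map (φ (hm₂.trans hp₂))) n₂
  rw [map_mul] at u₁ u₂
  obtain ⟨u, hu⟩ := u₁
  obtain ⟨v, hv⟩ := u₂
  refine isUnit_iff_exists_and_exists.2 
    ⟨⟨φ (hm₁.trans hp₁) (star b) * ↑v⁻¹, ?_⟩, ⟨↑u⁻¹ * φ (hm₁.trans hp₁) (star b), ?_⟩⟩
  · rw [← mul_assoc, ← hv, Units.mul_inv]
  · rw [mul_assoc, ← hu, Units.inv_mul]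
end

section
/- Assume the direct-limit setting for C*-algebras described in the context, with every A_λ and A unital and all the homomorphisms φ_{λ,μ}, φ_{λ,∞} unital. Then for every invertible element a of A there exist λ ∈ Λ and an invertible element b ∈ A_λ such that φ_{λ,∞}(b) lies in the same path component of Aˣ (the group of invertible elements of A, with the norm topology) as a. -/
theorem aux_norm.{u, v, w} {A : Type v} {B : Type w} [CStarAlgebra A] [CStarAlgebra B]
    (ψ : A →⋆ₐ[ℂ] B) (x : A) (hx : ‖ψ x‖ < 1) :
    ∃ k : A, ψ k = 0 ∧ ∃ ε > 0, ∀ (C : Type u) [CStarAlgebra C] (f : A →⋆ₐ[ℂ] C), ‖f k‖ < ε → ‖f x‖ < 1 := by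
  have hy : IsSelfAdjoint (star x * x) := IsSelfAdjoint.star_mul_self x
  set y := star x * x with hydef
  set r := ‖ψ y‖ with hr
  have hr0 : 0 ≤ r := norm_nonneg _
  have hr1 : r < 1 := by
    rw [hr, hydef, map_mul, map_star, CStarRing.norm_star_mul_self]
    nlinarith [norm_nonneg (ψ x)]
  have hc : Continuous (fun t : ℝ => max (-r) (min r t)) := by fun_prop
  have hψy : IsSelfAdjoint (ψ y) := hy.map ψ
  have hψc : Continuous ψ := 
    AddMonoidHomClass.continuous_of_bound ψ 1 (fun z => by
      simpa using NonUnitalStarAlgHom.norm_apply_le ψ z)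
  refine ⟨y - cfc (fun t : ℝ => max (-r) (min r t)) y, ?_, 1 - r, by linarith, ?_⟩
  · have h1 : ψ (cfc (fun t : ℝ => max (-r) (min r t)) y) = ψ y := by
      rcases subsingleton_or_nontrivial B with hB | hB
      · exact Subsingleton.elim _ _
      have h2 := StarAlgHomClass.map_cfc (R := ℝ) (S := ℂ) ψ (fun t : ℝ => max (-r) (min r t)) y
        hc.continuousOn hψc hy hψy
      rw [h2]
      conv_rhs => rw [← cfc_id ℝ (ψ y) hψy]
      apply cfc_congr
      intro t ht
      have h3 : ‖t‖ ≤ r := spectrum.norm_le_norm_of_mem ht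
      rw [Real.norm_eq_abs, abs_le] at h3
      simp [h3.1, h3.2]
    rw [map_sub, h1, sub_self]
  · intro C _ f hf
    have h4 : ‖cfc (fun t : ℝ => max (-r) (min r t)) y‖ ≤ r := by
      apply norm_cfc_le hr0
      intro t _
      rw [Real.norm_eq_abs, abs_le]
      exact ⟨le_max_left _ _, max_le (by linarith) (min_le_left _ _)⟩
    have h5 : ‖f y‖ < 1 := by
      have h6 : f y = f (y - cfc (fun t : ℝ => max (-r) (min r t)) y)
          + f (cfc (fun t : ℝ => max (-r) (min r t)) y) := by rw [← map_add]; simp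
      rw [h6]
      have h7 := NonUnitalStarAlgHom.norm_apply_le f (cfc (fun t : ℝ => max (-r) (min r t)) y)
      refine (norm_add_le _ _).trans_lt ?_
      linarith
    rw [hydef, map_mul, map_star, CStarRing.norm_star_mul_self] at h5
    nlinarith [norm_nonneg (f x)]

/-- In the direct-limit setting for unital C*-algebras (directed set `Λ`,
unital *-homomorphisms `φ_{λμ} : A_λ → A_μ` and `ψ_λ = φ_{λ∞} : A_λ → B` satisfying
compatibility, the norm condition, and density of `⋃_λ ψ_λ(A_λ)` in `B`):
for every invertible `a ∈ B` there exist `λ` and an invertible `b ∈ A_λ` such that `ψ_λ(b)`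
lies in the same path component of `Bˣ` (with the norm topology) as `a`. -/
theorem stmt_17
    {Λ : Type*} [Nonempty Λ] [Preorder Λ] [IsDirected Λ (· ≤ ·)]
    (A : Λ → Type*) [∀ l, CStarAlgebra (A l)]
    (B : Type*) [CStarAlgebra B]
    (φ : ∀ ⦃l m : Λ⦄, l ≤ m → (A l →⋆ₐ[ℂ] A m))
    (ψ : ∀ l : Λ, A l →⋆ₐ[ℂ] B)
    (hφrefl : ∀ (l : Λ) (a : A l), φ (le_refl l) a = a)
    (hφtrans : ∀ (l m p : Λ) (h1 : l ≤ m) (h2 : m ≤ p) (a : A l),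
      φ h2 (φ h1 a) = φ (h1.trans h2) a)
    (hcomp : ∀ (l m : Λ) (h : l ≤ m) (a : A l), ψ m (φ h a) = ψ l a)
    (hnorm : ∀ (l : Λ) (a : A l), ψ l a = 0 → ∀ ε > 0,
      ∃ (m : Λ) (hm : l ≤ m), ∀ (p : Λ) (hp : m ≤ p), ‖φ (hm.trans hp) a‖ < ε)
    (hdense : Dense (⋃ l : Λ, Set.range (ψ l))) :
    ∀ a : B, IsUnit a →
      ∃ (l : Λ) (b : A l), IsUnit b ∧
        JoinedIn {x : B | IsUnit x} (ψ l b) a := by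
  intro a ha
  -- eventual smallness
  have key : ∀ (l : Λ) (x : A l), ‖ψ l x‖ < 1 →
      ∃ (m : Λ) (hm : l ≤ m), ∀ (p : Λ) (hp : m ≤ p), ‖φ (hm.trans hp) x‖ < 1 := by
    intro l x hx
    obtain ⟨k, hk, ε, hε, hf⟩ := aux_norm (ψ l) x hx
    obtain ⟨m, hm, h⟩ := hnorm l k hk ε hε
    exact ⟨m, hm, fun p hp => hf (A p) _ (h p hp)⟩
  obtain ⟨ε, hε, hball⟩ := Metric.isOpen_iff.1 (Units.isOpen (R := B)) a ha
  obtain ⟨_, hc, hcU⟩ := hdense.exists_mem_open Metric.isOpen_ball ⟨a, Metric.mem_ball_self hε⟩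
  obtain ⟨l₁, c, rfl⟩ := Set.mem_iUnion.1 hc
  obtain ⟨u, hu⟩ := hball hcU
  have hopen : IsOpen {y : B | ‖1 - u * y‖ < 1 ∧ ‖1 - y * u‖ < 1} := by
    have c1 : Continuous (fun y : B => ‖1 - u * y‖) := by fun_prop
    have c2 : Continuous (fun y : B => ‖1 - y * u‖) := by fun_prop
    exact (isOpen_lt c1 continuous_const).inter (isOpen_lt c2 continuous_const)
  obtain ⟨_, hd, hd1, hd2⟩ := hdense.exists_mem_open hopen ⟨((u⁻¹ : Bˣ) : B), by simp⟩
  obtain ⟨l₂, d, rfl⟩ := Set.mem_iUnion.1 hd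
  obtain ⟨l, h1, h2⟩ := exists_ge_ge l₁ l₂
  have e1 : ‖ψ l (1 - φ h1 c * φ h2 d)‖ < 1 := by
    rw [map_sub, map_one, map_mul, hcomp, hcomp, ← hu]; exact hd1
  have e2 : ‖ψ l (1 - φ h2 d * φ h1 c)‖ < 1 := by
    rw [map_sub, map_one, map_mul, hcomp, hcomp, ← hu]; exact hd2
  obtain ⟨m₁, hm₁, k1⟩ := key l _ e1
  obtain ⟨m₂, hm₂, k2⟩ := key l _ e2
  obtain ⟨p, hp1, hp2⟩ := exists_ge_ge m₁ m₂
  have hlp : l ≤ p := hm₁.trans hp1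
  have k1 : ‖φ hlp (1 - φ h1 c * φ h2 d)‖ < 1 := k1 p hp1
  have k2 : ‖φ hlp (1 - φ h2 d * φ h1 c)‖ < 1 := k2 p hp2
  have u1 := isUnit_one_sub_of_norm_lt_one k1
  have u2 := isUnit_one_sub_of_norm_lt_one k2
  simp only [map_sub, map_one, map_mul, sub_sub_cancel] at u1 u2
  refine ⟨p, φ hlp (φ h1 c), ?_, ?_⟩
  · obtain ⟨v, hv⟩ := u1
    obtain ⟨w, hw⟩ := u2
    refine isUnit_iff_exists_and_exists.2 ⟨⟨φ hlp (φ h2 d) * ↑v⁻¹, ?_⟩, ⟨↑w⁻¹ * φ hlp (φ h2 d), ?_⟩⟩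
    · rw [← mul_assoc, ← hv, Units.mul_inv]
    · rw [mul_assoc, ← hw, Units.inv_mul]
  · rw [hcomp, hcomp]
    apply JoinedIn.of_segment_subset
    exact ((convex_ball a ε).segment_subset hcU (Metric.mem_ball_self hε)).trans hball
end

section
/- Assume the direct-limit setting for C*-algebras described in the context, with every A_λ and A unital and all the homomorphisms φ_{λ,μ}, φ_{λ,∞} unital. If λ ∈ Λ and b ∈ A_λ is invertible with φ_{λ,∞}(b) lying in the path component of the identity 1 in Aˣ (the group of invertible elements of A, with the norm topology), then there exists μ ≥ λ such that φ_{λ,μ}(b) is invertible and lies in the path component of 1 in A_μˣ. -/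
open Filter Topology

theorem aux_cont {A B : Type*} [CStarAlgebra A] [CStarAlgebra B] (f : A →⋆ₐ[ℂ] B) :
    Continuous f :=
  AddMonoidHomClass.continuous_of_bound f 1 (fun x => by
    rw [one_mul]; exact NonUnitalStarAlgHom.norm_apply_le f x)

theorem aux_open {B : Type*} [CStarAlgebra B] (w : B) :
    IsOpen {z : B | ‖z * w - 1‖ < 1 ∧ ‖w * z - 1‖ < 1} := by
  have h1 : IsOpen {z : B | ‖z * w - 1‖ < 1} := isOpen_lt (by fun_prop) continuous_const
  have h2 : IsOpen {z : B | ‖w * z - 1‖ < 1} := isOpen_lt (by fun_prop) continuous_const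
  exact h1.inter h2

theorem aux_norm_le {A B : Type*} [CStarAlgebra A] [CStarAlgebra B] (f : A →⋆ₐ[ℂ] B) (a : A) :
    ∃ u c : A, star a * a = u + c ∧ ‖u‖ ≤ ‖f a‖ ^ 2 ∧ f c = 0 := by
  have hsa : IsSelfAdjoint (star a * a) := IsSelfAdjoint.star_mul_self a
  set d : ℝ := ‖f a‖ ^ 2 with hd
  have hd0 : 0 ≤ d := by positivity
  refine ⟨cfc (fun t : ℝ => min t d) (star a * a), cfc (fun t : ℝ => max (t - d) 0) (star a * a),
    ?_, ?_, ?_⟩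
  · rw [← cfc_add (a := star a * a) (fun t : ℝ => min t d) (fun t : ℝ => max (t - d) 0)]
    conv_lhs => rw [← cfc_id ℝ (star a * a)]
    congr 1
    funext t
    simp only [id]
    rcases le_total t d with h | h
    · rw [min_eq_left h, max_eq_right (by linarith)]; ring
    · rw [min_eq_right h, max_eq_left (by linarith)]; ring
  · refine norm_cfc_le hd0 ?_
    intro t ht
    have h0 : 0 ≤ t := by
      let := CStarAlgebra.spectralOrder A
      have := CStarAlgebra.spectralOrderedRing A
      exact spectrum_nonneg_of_nonneg (star_mul_self_nonneg a) ht
    rw [Real.norm_of_nonneg (le_min h0 hd0)]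
    exact min_le_right _ _
  · have hfc : Continuous f := aux_cont f
    have := StarAlgHom.map_cfc (S := ℂ) f (fun t : ℝ => max (t - d) 0) (star a * a)
      (by fun_prop) hfc hsa (hsa.map f)
    rw [this]
    have h2 : cfc (fun t : ℝ => max (t - d) 0) (f (star a * a)) =
        cfc (fun _ : ℝ => (0 : ℝ)) (f (star a * a)) := by
      apply cfc_congr
      intro t ht
      have h1 : ‖t‖ ≤ ‖f (star a * a)‖ := by
        rcases subsingleton_or_nontrivial B with hB | hB
        · rw [spectrum.of_subsingleton] at ht
          exact absurd ht (Set.notMem_empty t)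
        exact spectrum.norm_le_norm_of_mem ht
      have h3 : ‖f (star a * a)‖ = d := by
        rw [map_mul, map_star, CStarRing.norm_star_mul_self, hd, sq]
      have := le_abs_self t
      rw [Real.norm_eq_abs] at h1
      exact max_eq_right (by linarith)
    rw [h2, cfc_const_zero]

theorem aux_isUnit {R : Type*} [CStarAlgebra R] {c a : R} (h1 : ‖c * a - 1‖ < 1)
    (h2 : ‖a * c - 1‖ < 1) : IsUnit a := by
  have key : ∀ x : R, ‖x - 1‖ < 1 → IsUnit x := by
    intro x hx
    have := isUnit_one_sub_of_norm_lt_one (x := 1 - x) (by rwa [norm_sub_rev])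
    simpa using this
  obtain ⟨u, hu⟩ := key _ h1
  obtain ⟨v, hv⟩ := key _ h2
  have e1 : ((↑u⁻¹ : R) * c) * a = 1 := by rw [mul_assoc, ← hu, Units.inv_mul]
  have e2 : a * (c * (↑v⁻¹ : R)) = 1 := by rw [← mul_assoc, ← hv, Units.mul_inv]
  have e3 := left_inv_eq_right_inv e1 e2
  exact ⟨⟨a, c * (↑v⁻¹ : R), e2, by rw [← e3]; exact e1⟩, rfl⟩

theorem aux_joined {R : Type*} [CStarAlgebra R] {c a a' : R} (h1 : ‖c * a - 1‖ < 1)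
    (h2 : ‖a * c - 1‖ < 1) (h1' : ‖c * a' - 1‖ < 1)
    (h2' : ‖a' * c - 1‖ < 1) : JoinedIn {x : R | IsUnit x} a a' := by
  apply JoinedIn.of_segment_subset
  rintro _ ⟨s, t, hs, ht, hst, rfl⟩
  have cv := convex_ball (1 : R) 1
  rw [← dist_eq_norm, ← Metric.mem_ball] at h1 h2 h1' h2'
  have k1 := cv h1 h1' hs ht hst
  have k2 := cv h2 h2' hs ht hst
  apply aux_isUnit (c := c)
  · rw [← dist_eq_norm, ← Metric.mem_ball, mul_add, mul_smul_comm, mul_smul_comm]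
    exact k1
  · rw [← dist_eq_norm, ← Metric.mem_ball, add_mul, smul_mul_assoc, smul_mul_assoc]
    exact k2

/-- In the direct-limit setting for unital C*-algebras (directed set `Λ`,
unital *-homomorphisms `φ_{λμ} : A_λ → A_μ` and `ψ_λ = φ_{λ∞} : A_λ → B` satisfying
compatibility, the norm condition, and density of `⋃_λ ψ_λ(A_λ)` in `B`):
if `b ∈ A_λ` is invertible and `ψ_λ(b)` lies in the path component of `1` in `Bˣ`, then there
is `μ ≥ λ` such that `φ_{λμ}(b)` is invertible and lies in the path component of `1`
in `A_μˣ`. -/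
theorem stmt_18
    {Λ : Type*} [Nonempty Λ] [Preorder Λ] [IsDirected Λ (· ≤ ·)]
    (A : Λ → Type*) [∀ l, CStarAlgebra (A l)]
    (B : Type*) [CStarAlgebra B]
    (φ : ∀ ⦃l m : Λ⦄, l ≤ m → (A l →⋆ₐ[ℂ] A m))
    (ψ : ∀ l : Λ, A l →⋆ₐ[ℂ] B)
    (hφrefl : ∀ (l : Λ) (a : A l), φ (le_refl l) a = a)
    (hφtrans : ∀ (l m p : Λ) (h1 : l ≤ m) (h2 : m ≤ p) (a : A l),
      φ h2 (φ h1 a) = φ (h1.trans h2) a)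
    (hcomp : ∀ (l m : Λ) (h : l ≤ m) (a : A l), ψ m (φ h a) = ψ l a)
    (hnorm : ∀ (l : Λ) (a : A l), ψ l a = 0 → ∀ ε > 0,
      ∃ (m : Λ) (hm : l ≤ m), ∀ (p : Λ) (hp : m ≤ p), ‖φ (hm.trans hp) a‖ < ε)
    (hdense : Dense (⋃ l : Λ, Set.range (ψ l))) :
    ∀ (l : Λ) (b : A l), IsUnit b →
      JoinedIn {x : B | IsUnit x} (ψ l b) 1 →
      ∃ (m : Λ) (h : l ≤ m), IsUnit (φ h b) ∧
        JoinedIn {x : A m | IsUnit x} (φ h b) 1 := by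
  have key : ∀ (l : Λ) (a : A l), ‖ψ l a‖ < 1 → ∃ (m : Λ) (hm : l ≤ m),
      ∀ (p : Λ) (hp : m ≤ p), ‖φ (hm.trans hp) a‖ < 1 := by
    intro l a ha
    obtain ⟨u, c, huc, hu, hc⟩ := aux_norm_le (ψ l) a
    have hlt : ‖ψ l a‖ ^ 2 < 1 := by
      have := norm_nonneg (ψ l a)
      nlinarith
    obtain ⟨m, hm, H⟩ := hnorm l c hc (1 - ‖ψ l a‖ ^ 2) (by linarith)
    refine ⟨m, hm, fun p hp => ?_⟩
    have h1 := H p hp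
    have h2 : ‖φ (hm.trans hp) a‖ * ‖φ (hm.trans hp) a‖ =
        ‖φ (hm.trans hp) u + φ (hm.trans hp) c‖ := by
      rw [← CStarRing.norm_star_mul_self, ← map_star, ← map_mul, huc, map_add]
    have h3 := norm_add_le (φ (hm.trans hp) u) (φ (hm.trans hp) c)
    have h4 : ‖φ (hm.trans hp) u‖ ≤ ‖u‖ := NonUnitalStarAlgHom.norm_apply_le _ u
    have := norm_nonneg (φ (hm.trans hp) a)
    nlinarith
  -- local statement
  have loc : ∀ x : B, IsUnit x → ∃ U : Set B, IsOpen U ∧ x ∈ U ∧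
      ∀ (l l' : Λ) (a : A l) (a' : A l'), ψ l a ∈ U → ψ l' a' ∈ U →
      ∃ (m : Λ) (h : l ≤ m) (h' : l' ≤ m),
        JoinedIn {x : A m | IsUnit x} (φ h a) (φ h' a') := by
    rintro x ⟨w, rfl⟩
    have hopen : IsOpen {z : B | ‖z * w - 1‖ < 1 ∧ ‖w * z - 1‖ < 1} := aux_open _
    obtain ⟨_, hz, hzm⟩ := hdense.inter_open_nonempty _ hopen ⟨(↑w⁻¹ : B), by simp⟩
    obtain ⟨k, c, rfl⟩ := Set.mem_iUnion.1 hzm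
    refine ⟨{y : B | ‖y * ψ k c - 1‖ < 1 ∧ ‖ψ k c * y - 1‖ < 1}, aux_open _,
      ⟨hz.2, hz.1⟩, ?_⟩
    -- single element statement
    have one : ∀ (l : Λ) (a : A l), ‖ψ k c * ψ l a - 1‖ < 1 → ‖ψ l a * ψ k c - 1‖ < 1 →
        ∃ (m : Λ) (h : l ≤ m) (hk : k ≤ m), ∀ (p : Λ) (hp : m ≤ p),
          ‖φ (hk.trans hp) c * φ (h.trans hp) a - 1‖ < 1 ∧
          ‖φ (h.trans hp) a * φ (hk.trans hp) c - 1‖ < 1 := by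
      intro l a h1 h2
      obtain ⟨n, hln, hkn⟩ := exists_ge_ge l k
      obtain ⟨m1, hm1, H1⟩ := key n (φ hkn c * φ hln a - 1) (by
        simpa only [map_sub, map_mul, map_one, hcomp] using h1)
      obtain ⟨m2, hm2, H2⟩ := key n (φ hln a * φ hkn c - 1) (by
        simpa only [map_sub, map_mul, map_one, hcomp] using h2)
      obtain ⟨m, hm1m, hm2m⟩ := exists_ge_ge m1 m2
      refine ⟨m, hln.trans (hm1.trans hm1m), hkn.trans (hm1.trans hm1m), fun p hp => ⟨?_, ?_⟩⟩
      · simpa only [map_sub, map_mul, map_one, hφtrans] using H1 p (hm1m.trans hp)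
      · simpa only [map_sub, map_mul, map_one, hφtrans] using H2 p (hm2m.trans hp)
    intro l l' a a' ha ha'
    obtain ⟨m1, hl1, hk1, H1⟩ := one l a ha.2 ha.1
    obtain ⟨m2, hl2, hk2, H2⟩ := one l' a' ha'.2 ha'.1
    obtain ⟨m, h1m, h2m⟩ := exists_ge_ge m1 m2
    exact ⟨m, hl1.trans h1m, hl2.trans h2m,
      aux_joined (H1 m h1m).1 (H1 m h1m).2 (H2 m h2m).1 (H2 m h2m).2⟩
  have push : ∀ (m p : Λ) (h : m ≤ p) (x y : A m), JoinedIn {x : A m | IsUnit x} x y →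
      JoinedIn {x : A p | IsUnit x} (φ h x) (φ h y) := by
    intro m p h x y hxy
    refine (hxy.map_continuousOn (aux_cont (φ h)).continuousOn).mono ?_
    rintro _ ⟨z, hz, rfl⟩
    exact IsUnit.map (φ h) hz
  let G : B → Prop := fun y => ∀ (l : Λ) (a : A l), ψ l a = y →
    ∃ (m : Λ) (h : l ≤ m), JoinedIn {x : A m | IsUnit x} (φ h a) 1
  let S : Set B := {x | ∀ᶠ y in 𝓝 x, G y}
  have hSo : IsOpen S := isOpen_setOfPred_eventually_nhds
  have h1S : (1 : B) ∈ S := by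
    obtain ⟨U, hU, h1U, H⟩ := loc 1 isUnit_one
    filter_upwards [hU.mem_nhds h1U] with y hy l a hay
    obtain ⟨m, h, h', hj⟩ := H l l a 1 (by rwa [hay]) (by rwa [map_one])
    refine ⟨m, h, ?_⟩
    rwa [map_one] at hj
  have hclS : ∀ x : B, IsUnit x → x ∈ closure S → x ∈ S := by
    intro x hx hxS
    obtain ⟨U, hU, hxU, H⟩ := loc x hx
    obtain ⟨_, ⟨hyU, hyS⟩, hym⟩ := hdense.inter_open_nonempty _ (hU.inter hSo)
      (mem_closure_iff.1 hxS U hU hxU)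
    obtain ⟨k, a', rfl⟩ := Set.mem_iUnion.1 hym
    obtain ⟨m', hm', hj'⟩ := Eventually.self_of_nhds hyS k a' rfl
    filter_upwards [hU.mem_nhds hxU] with y hy l a hay
    obtain ⟨m, h, h', hj⟩ := H l k a a' (by rwa [hay]) hyU
    obtain ⟨p, hmp, hmp'⟩ := exists_ge_ge m m'
    refine ⟨p, h.trans hmp, ?_⟩
    have j1 := push m p hmp _ _ hj
    have j2 := push m' p hmp' _ _ hj'
    rw [hφtrans, hφtrans] at j1
    rw [hφtrans, map_one] at j2
    exact j1.trans j2
  intro l b hb hjoin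
  obtain ⟨γ, hγ⟩ := hjoin
  have hclopen : IsClopen (γ ⁻¹' S) := by
    refine ⟨?_, hSo.preimage γ.continuous⟩
    rw [← closure_subset_iff_isClosed]
    intro t ht
    exact hclS _ (hγ t) (γ.continuous.closure_preimage_subset S ht)
  have huniv := hclopen.eq_univ ⟨1, by simpa using h1S⟩
  have h0 : (0 : unitInterval) ∈ γ ⁻¹' S := by rw [huniv]; trivial
  have h0S : ψ l b ∈ S := by simpa using h0
  obtain ⟨m, h, hj⟩ := Eventually.self_of_nhds h0S l b rfl
  exact ⟨m, h, hj.source_mem, hj⟩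
end

section
/- Assume the direct-limit setting for C*-algebras described in the context. Let Y be a compact Hausdorff space. For a C*-algebra B, let C(Y, B) denote the C*-algebra of continuous functions Y → B with pointwise operations and the sup norm ‖b‖ = sup_{y∈Y} ‖b(y)‖, and let φ̄_{λ,μ} : C(Y, A_λ) → C(Y, A_μ) and φ̄_{λ,∞} : C(Y, A_λ) → C(Y, A) be post-composition with φ_{λ,μ} and φ_{λ,∞} respectively. Then: (1) if b ∈ C(Y, A_λ) satisfies φ̄_{λ,∞}(b) = 0 (i.e. φ_{λ,∞}(b(y)) = 0 for all y ∈ Y), then lim_μ ‖φ̄_{λ,μ}(b)‖ = 0, i.e. for every ε > 0 there is μ₀ ≥ λ with sup_{y∈Y} ‖φ_{λ,μ}(b(y))‖ < ε for all μ ≥ μ₀; and (2) the union ⋃_λ φ̄_{λ,∞}(C(Y, A_λ)) is dense in C(Y, A). (Thus C(Y, A) satisfies the direct-limit characterization for the system (C(Y, A_λ)).) -/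
/-- In the direct-limit setting for C*-algebras (directed set `Λ`,
*-homomorphisms `φ_{λμ} : A_λ → A_μ` and `ψ_λ = φ_{λ∞} : A_λ → B` satisfying compatibility,
the norm condition, and density of `⋃_λ ψ_λ(A_λ)` in `B`), and `Y` a compact Hausdorff space:
(1) if `b ∈ C(Y, A_λ)` satisfies `ψ_λ(b(y)) = 0` for all `y`, then
`lim_μ ‖φ̄_{λμ}(b)‖ = 0` (sup norm); and (2) the union `⋃_λ φ̄_{λ∞}(C(Y, A_λ))` is dense in
`C(Y, B)`.  Thus `C(Y, B)` satisfies the direct-limit characterization for the system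
`(C(Y, A_λ))`. -/
theorem stmt_19
    {Λ : Type*} [Nonempty Λ] [Preorder Λ] [IsDirected Λ (· ≤ ·)]
    (A : Λ → Type*) [∀ l, NonUnitalCStarAlgebra (A l)]
    (B : Type*) [NonUnitalCStarAlgebra B]
    (φ : ∀ ⦃l m : Λ⦄, l ≤ m → (A l →⋆ₙₐ[ℂ] A m))
    (ψ : ∀ l : Λ, A l →⋆ₙₐ[ℂ] B)
    (hφrefl : ∀ (l : Λ) (a : A l), φ (le_refl l) a = a)
    (hφtrans : ∀ (l m p : Λ) (h1 : l ≤ m) (h2 : m ≤ p) (a : A l),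
      φ h2 (φ h1 a) = φ (h1.trans h2) a)
    (hcomp : ∀ (l m : Λ) (h : l ≤ m) (a : A l), ψ m (φ h a) = ψ l a)
    (hnorm : ∀ (l : Λ) (a : A l), ψ l a = 0 → ∀ ε > 0,
      ∃ (m : Λ) (hm : l ≤ m), ∀ (p : Λ) (hp : m ≤ p), ‖φ (hm.trans hp) a‖ < ε)
    (hdense : Dense (⋃ l : Λ, Set.range (ψ l)))
    (Y : Type*) [TopologicalSpace Y] [CompactSpace Y] [T2Space Y] :
    -- (1) the norm condition for the system `(C(Y, A_λ))`
    (∀ (l : Λ) (b : C(Y, A l)), (∀ y : Y, ψ l (b y) = 0) → ∀ ε > 0,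
      ∃ (m : Λ) (hm : l ≤ m), ∀ (p : Λ) (hp : m ≤ p),
        (⨆ y : Y, ‖φ (hm.trans hp) (b y)‖) < ε) ∧
    -- (2) density of `⋃_λ φ̄_{λ∞}(C(Y, A_λ))` in `C(Y, B)`
    Dense {g : C(Y, B) | ∃ (l : Λ) (a : C(Y, A l)), ∀ y : Y, g y = ψ l (a y)} := by
  constructor
  · intro l b hb ε hε
    have h3 : 0 < ε / 3 := by positivity
    choose m hm hmp using fun y : Y => hnorm l (b y) (hb y) (ε / 3) h3
    obtain ⟨t, ht⟩ := CompactSpace.elim_nhds_subcover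
      (fun y : Y => {z : Y | ‖b z - b y‖ < ε / 3}) (fun y => by
        apply IsOpen.mem_nhds
        · exact isOpen_lt (by fun_prop) continuous_const
        · simpa using h3)
    classical
    obtain ⟨M, hM⟩ := (insert l (t.image m)).exists_le
    have hl : l ≤ M := hM l (by simp)
    refine ⟨M, hl, fun p hp => ?_⟩
    refine lt_of_le_of_lt (b := ε / 3 + ε / 3) (Real.iSup_le (fun z => ?_) (by positivity))
      (by linarith)
    have hz : z ∈ ⋃ y ∈ t, {z : Y | ‖b z - b y‖ < ε / 3} := by rw [ht]; trivial
    simp only [Set.mem_iUnion, Set.mem_setOf_eq] at hz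
    obtain ⟨y, hy, hzy⟩ := hz
    have hmy : m y ≤ M := hM _ (by
      simp only [Finset.mem_insert, Finset.mem_image]; exact Or.inr ⟨y, hy, rfl⟩)
    have h1 := hmp y p (hmy.trans hp)
    have h2 := NonUnitalStarAlgHom.norm_apply_le (φ (hl.trans hp)) (b z - b y)
    rw [map_sub] at h2
    have h4 := norm_add_le (φ (hl.trans hp) (b z) - φ (hl.trans hp) (b y))
      (φ (hl.trans hp) (b y))
    rw [sub_add_cancel] at h4
    linarith
  · rw [Metric.dense_iff]
    intro f ε hε
    have h2 : 0 < ε / 2 := by positivity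
    have key : ∀ y : Y, ∃ (l : Λ) (a : A l), ‖f y - ψ l a‖ < ε / 2 := by
      intro y
      obtain ⟨x, hx, hxd⟩ := hdense.exists_dist_lt (f y) h2
      obtain ⟨l, a, rfl⟩ := Set.mem_iUnion.1 hx
      exact ⟨l, a, by rwa [← dist_eq_norm]⟩
    choose k a ha using key
    have hopen : ∀ c : B, IsOpen {z : Y | ‖f z - c‖ < ε / 2} := fun c =>
      isOpen_lt (by fun_prop) continuous_const
    obtain ⟨t, ht⟩ := CompactSpace.elim_nhds_subcover
      (fun y : Y => {z : Y | ‖f z - ψ (k y) (a y)‖ < ε / 2})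
      (fun y => (hopen _).mem_nhds (ha y))
    classical
    obtain ⟨M, hM⟩ := (t.image k).exists_le
    obtain ⟨g, hg⟩ := exists_continuous_forall_mem_convex_of_local_const (X := Y) (E := A M)
      (t := fun z => {c : A M | ‖f z - ψ M c‖ < ε / 2}) (fun z => by
        have hc := (convex_ball (f z) (ε / 2)).linear_preimage
          ((ψ M : A M →ₗ[ℂ] B).restrictScalars ℝ)
        convert! hc using 1
        ext c
        simp [dist_eq_norm, norm_sub_rev]) (fun z => by
        have hz : z ∈ ⋃ y ∈ t, {z : Y | ‖f z - ψ (k y) (a y)‖ < ε / 2} := by rw [ht]; trivial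
        simp only [Set.mem_iUnion, Set.mem_setOf_eq] at hz
        obtain ⟨y, hy, hzy⟩ := hz
        have hk : k y ≤ M := hM _ (Finset.mem_image_of_mem _ hy)
        refine ⟨φ hk (a y), ?_⟩
        filter_upwards [(hopen (ψ (k y) (a y))).mem_nhds hzy] with w hw
        simpa [hcomp] using hw)
    have hψ : Continuous (ψ M) := by
      exact AddMonoidHomClass.continuous_of_bound (ψ M) 1
        (fun x => by simpa using NonUnitalStarAlgHom.norm_apply_le (ψ M) x)
    refine ⟨⟨fun y => ψ M (g y), hψ.comp g.continuous⟩, ?_, M, g, fun y => rfl⟩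
    rw [Metric.mem_ball, dist_comm]
    refine lt_of_le_of_lt ((ContinuousMap.dist_le h2.le).2 fun y => ?_) (half_lt_self hε)
    rw [dist_eq_norm]
    exact (hg y).le
end
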